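/- arXiv:math/0609453 — 3 statements merged into one kernel-verified Lean document; each statement's English description precedes it below -/
import Mathlib

section
/- Let R be a commutative Noetherian ring of Krull dimension d, I an ideal, and M an R-module. Then the local cohomology modules H^i_I(M) vanish for i > d. -/
open CategoryTheory Limits Opposite

universe u

section Torsion

variable {R : Type u} [CommRing R]

namespace Submodule

/-- The submodule of elements annihilated by some power of the ideal `J`. -/
def powTorsion (J : Ideal R) (M : Type*) [AddCommGroup M] [Module R M] : Submodule R M where
  carrier := {x | ∃ n : ℕ, ∀ r ∈ J ^ n, r • x = 0}
  zero_mem' := ⟨0, fun r _ => smul_zero r⟩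
  add_mem' := by
    rintro x y ⟨n, hn⟩ ⟨m, hm⟩
    refine ⟨max n m, fun r hr => ?_⟩
    rw [smul_add, hn r (Ideal.pow_le_pow_right (le_max_left n m) hr),
      hm r (Ideal.pow_le_pow_right (le_max_right n m) hr), add_zero]
  smul_mem' := by
    rintro c x ⟨n, hn⟩
    exact ⟨n, fun r hr => by rw [smul_comm, hn r hr, smul_zero]⟩

end Submodule

open Submodule

/-- Every element of `M` is annihilated by some power of the ideal `J`. -/
def Module.IsPowTorsion (J : Ideal R) (M : Type*) [AddCommGroup M] [Module R M] : Prop :=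
  ∀ x : M, ∃ n : ℕ, ∀ r ∈ J ^ n, r • x = 0

namespace Module.IsPowTorsion

variable {J K : Ideal R} {M N : Type*} [AddCommGroup M] [Module R M] [AddCommGroup N] [Module R N]

lemma powTorsion (J : Ideal R) (M : Type*) [AddCommGroup M] [Module R M] :
    IsPowTorsion J (powTorsion J M) := by
  rintro ⟨x, n, hn⟩
  exact ⟨n, fun r hr => Subtype.ext (hn r hr)⟩

lemma of_le (h : IsPowTorsion J M) (hK : K ≤ J) : IsPowTorsion K M := fun x =>
  (h x).imp fun n hn r hr => hn r (Ideal.pow_right_mono hK n hr)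

lemma of_surjective (h : IsPowTorsion J M) (f : M →ₗ[R] N) (hf : Function.Surjective f) :
    IsPowTorsion J N := by
  intro y
  obtain ⟨x, rfl⟩ := hf y
  exact (h x).imp fun n hn r hr => by rw [← map_smul, hn r hr, map_zero]

lemma subsingleton_of_top (h : IsPowTorsion (⊤ : Ideal R) M) : Subsingleton M := by
  refine subsingleton_of_forall_eq 0 fun x => ?_
  obtain ⟨n, hn⟩ := h x
  simpa using hn 1 (by simp [Ideal.top_pow])

lemma bot : IsPowTorsion (⊥ : Ideal R) M := fun x => ⟨1, fun r hr => by
  rw [pow_one, Ideal.mem_bot] at hr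
  rw [hr, zero_smul]⟩

/-- If `J * K ≤ L` and `M` is `L`-torsion, then `M / Γ_J(M)` is `K`-torsion. -/
lemma quotient_powTorsion {L : Ideal R} (hJK : J * K ≤ L) (h : IsPowTorsion L M) :
    IsPowTorsion K (M ⧸ Submodule.powTorsion J M) := by
  intro y
  obtain ⟨x, rfl⟩ := Submodule.Quotient.mk_surjective _ y
  obtain ⟨n, hn⟩ := h x
  refine ⟨n, fun r hr => ?_⟩
  rw [← Submodule.Quotient.mk_smul, Submodule.Quotient.mk_eq_zero]
  refine ⟨n, fun s hs => ?_⟩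
  rw [smul_smul]
  refine hn _ (Ideal.pow_right_mono hJK n ?_)
  rw [mul_pow]
  exact Ideal.mul_mem_mul hs hr

lemma sup_span_singleton {a : R} {n : ℕ} (h : IsPowTorsion J M) (ha : ∀ x : M, a ^ n • x = 0) :
    IsPowTorsion (J ⊔ Ideal.span {a}) M := by
  intro x
  obtain ⟨m, hm⟩ := h x
  refine ⟨m + n, fun r hr => ?_⟩
  have := Ideal.sup_pow_add_le_pow_sup_pow (I := J) (J := Ideal.span {a}) (n := m) (m := n) hr
  rw [Ideal.span_singleton_pow] at this
  obtain ⟨s, hs, t, ht, rfl⟩ := Submodule.mem_sup.1 this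
  obtain ⟨c, rfl⟩ := Ideal.mem_span_singleton'.1 ht
  rw [add_smul, hm s hs, mul_smul, ha, smul_zero, add_zero]

lemma powTorsion_span_singleton (h : IsPowTorsion J M) (a : R) :
    IsPowTorsion (J ⊔ Ideal.span {a}) (Submodule.powTorsion (Ideal.span {a}) M) := by
  rintro ⟨x, n, hn⟩
  obtain ⟨m, hm⟩ := h x
  refine ⟨m + n, fun r hr => Subtype.ext ?_⟩
  have := Ideal.sup_pow_add_le_pow_sup_pow (I := J) (J := Ideal.span {a}) (n := m) (m := n) hr
  obtain ⟨s, hs, t, ht, rfl⟩ := Submodule.mem_sup.1 this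
  change (s + t) • x = 0
  rw [add_smul, hm s hs, hn t ht, add_zero]

end Module.IsPowTorsion

lemma Submodule.isSMulRegular_quotient_powTorsion_span_singleton {M : Type*} [AddCommGroup M]
    [Module R M] (a : R) : IsSMulRegular (M ⧸ powTorsion (Ideal.span {a}) M) a := by
  rw [isSMulRegular_iff_right_eq_zero_of_smul]
  intro y hy
  obtain ⟨x, rfl⟩ := Submodule.Quotient.mk_surjective _ y
  rw [← Submodule.Quotient.mk_smul, Submodule.Quotient.mk_eq_zero] at hy
  rw [Submodule.Quotient.mk_eq_zero]
  obtain ⟨n, hn⟩ := hy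
  refine ⟨n + 1, fun r hr => ?_⟩
  rw [Ideal.span_singleton_pow, Ideal.mem_span_singleton'] at hr
  obtain ⟨c, rfl⟩ := hr
  rw [pow_succ, ← mul_assoc, mul_smul]
  exact hn _ (by rw [Ideal.span_singleton_pow]; exact Ideal.mem_span_singleton'.2 ⟨c, rfl⟩)

/-- Over a Noetherian ring, the torsion submodule of an injective module is injective. -/
lemma Module.Injective.powTorsion [IsNoetherianRing R] (I : Ideal R) (E : Type u)
    [AddCommGroup E] [Module R E] [Module.Injective R E] :
    Module.Injective R (Submodule.powTorsion I E) := by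
  refine Module.Baer.injective fun J g => ?_
  obtain ⟨n, hn⟩ : ∃ n : ℕ, ∀ r ∈ I ^ n, ∀ x : J, r • g x = 0 := by
    have hfg : (⊤ : Submodule R J).FG := Module.Finite.fg_top
    obtain ⟨s, hs⟩ := hfg
    choose k hk using fun x : J => Module.IsPowTorsion.powTorsion I E (g x)
    refine ⟨s.sup k, fun r hr x => ?_⟩
    have hx : x ∈ Submodule.span R (s : Set J) := hs ▸ Submodule.mem_top
    induction hx using Submodule.span_induction with
    | mem x hx => exact hk x r (Ideal.pow_le_pow_right (Finset.le_sup hx) hr)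
    | zero => simp
    | add x y _ _ hx hy => rw [map_add, smul_add, hx, hy, add_zero]
    | smul c x _ hx => rw [map_smul, smul_comm, hx, smul_zero]
  obtain ⟨k, hk⟩ := Ideal.exists_pow_inf_eq_pow_smul (M := R) I J
  have hker : ∀ x : J, (x : R) ∈ I ^ (n + k) → g x = 0 := by
    intro x hx
    have h1 : (x : R) ∈ I ^ n • (I ^ k • (⊤ : Ideal R) ⊓ J) := by
      have := hk (n + k) (Nat.le_add_left k n)
      rw [Nat.add_sub_cancel] at this
      rw [← this]
      exact ⟨by simpa using hx, x.2⟩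
    have h2 : (x : R) ∈ (I ^ n • (⊤ : Submodule R J)).map J.subtype := by
      rw [Submodule.map_smul'', Submodule.map_top, Submodule.range_subtype]
      exact Submodule.smul_mono le_rfl inf_le_right h1
    obtain ⟨y, hy, hyx⟩ := h2
    obtain rfl : y = x := Subtype.ext hyx
    refine Submodule.smul_induction_on hy (fun r hr z _ => ?_) fun x y hx hy => ?_
    · rw [map_smul, hn r hr]
    · rw [map_add, hx, hy, add_zero]
  -- extend along the injection `J / (J ∩ I ^ (n + k)) → R / I ^ (n + k)`
  let q : J →ₗ[R] R ⧸ I ^ (n + k) := (I ^ (n + k)).mkQ ∘ₗ J.subtype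
  have hq : LinearMap.ker q ≤ LinearMap.ker g := fun x hx =>
    hker x (by simpa [q, Ideal.Quotient.eq_zero_iff_mem] using hx)
  obtain ⟨l, hl⟩ := Module.Injective.out ((LinearMap.ker q).liftQ q le_rfl)
    (LinearMap.ker_eq_bot.1 (Submodule.ker_liftQ_eq_bot' _ q rfl))
    ((Submodule.powTorsion I E).subtype ∘ₗ (LinearMap.ker q).liftQ g hq)
  have hmem : ∀ y, l y ∈ Submodule.powTorsion I E := by
    intro y
    refine ⟨n + k, fun r hr => ?_⟩
    rw [← map_smul]
    obtain ⟨z, rfl⟩ := Submodule.Quotient.mk_surjective _ y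
    rw [← Submodule.Quotient.mk_smul, (Submodule.Quotient.mk_eq_zero _).2
      (show r • z ∈ _ from Ideal.mul_mem_right z _ hr), map_zero]
  refine ⟨(l.codRestrict _ hmem) ∘ₗ (I ^ (n + k)).mkQ, fun x mem => Subtype.ext ?_⟩
  exact hl (Submodule.Quotient.mk ⟨x, mem⟩)

lemma ringKrullDim_quotient_sup_span_singleton_add_one_le {p : Ideal R} [p.IsPrime] {a : R}
    (ha : a ∉ p) : ringKrullDim (R ⧸ p ⊔ Ideal.span {a}) + 1 ≤ ringKrullDim (R ⧸ p) := by
  have h := ringKrullDim_quotient_succ_le_of_nonZeroDivisor (R := R ⧸ p)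
    (r := Ideal.Quotient.mk p a) (mem_nonZeroDivisors_of_ne_zero
      (by rwa [Ne, Ideal.Quotient.eq_zero_iff_mem]))
  have e := DoubleQuot.quotQuotEquivQuotSup p (Ideal.span {a})
  rw [Ideal.map_span, Set.image_singleton] at e
  rwa [ringKrullDim_eq_of_ringEquiv e] at h

end Torsion

namespace LocalCohomology

open Abelian

variable {R : Type u} [CommRing R]

/-- The projection `R / I ^ m → R / I ^ n` for `n ≤ m`. -/
noncomputable def quotientPowMap (I : Ideal R) {n m : ℕ} (h : n ≤ m) :
    ModuleCat.of R (R ⧸ I ^ m) ⟶ ModuleCat.of R (R ⧸ I ^ n) :=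
  ModuleCat.ofHom (Submodule.mapQ _ _ LinearMap.id (Ideal.pow_le_pow_right h))

lemma quotientPowMap_comp (I : Ideal R) {n m k : ℕ} (h : n ≤ m) (h' : m ≤ k) :
    quotientPowMap I h' ≫ quotientPowMap I h = quotientPowMap I (h.trans h') := by
  refine ModuleCat.hom_ext (LinearMap.ext fun x => ?_)
  obtain ⟨x, rfl⟩ := Submodule.Quotient.mk_surjective _ x
  rfl

/-- Every class in `Ext^i(R / I ^ n, M)` dies in some `Ext^i(R / I ^ m, M)`. -/
def ExtVanishes (I : Ideal R) (i : ℕ) (M : ModuleCat.{u} R) : Prop :=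
  ∀ (n : ℕ) (ξ : Ext (ModuleCat.of R (R ⧸ I ^ n)) M i), ∃ (m : ℕ) (h : n ≤ m),
    (Ext.mk₀ (quotientPowMap I h)).comp ξ (zero_add i) = 0

variable {I : Ideal R} {i : ℕ}

namespace ExtVanishes

lemma of_subsingleton (M : ModuleCat.{u} R) [Subsingleton M] : ExtVanishes I i M := by
  intro n ξ
  refine ⟨n, le_rfl, ?_⟩
  have hM : IsZero M := ModuleCat.isZero_of_subsingleton M
  rw [← Ext.comp_mk₀_id ξ, hM.eq_of_src (𝟙 M) 0, Ext.mk₀_zero, Ext.comp_zero, Ext.comp_zero]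

lemma of_shortExact {S : ShortComplex (ModuleCat.{u} R)} (hS : S.ShortExact)
    (h₁ : ExtVanishes I i S.X₁) (h₃ : ExtVanishes I i S.X₃) : ExtVanishes I i S.X₂ := by
  intro n ξ
  obtain ⟨m, hm, h⟩ := h₃ n (ξ.comp (Ext.mk₀ S.g) (add_zero i))
  rw [← Ext.comp_assoc_of_third_deg_zero] at h
  obtain ⟨η, hη⟩ := Ext.covariant_sequence_exact₂ _ hS _ h
  obtain ⟨k, hk, h'⟩ := h₁ m η
  refine ⟨k, hm.trans hk, ?_⟩
  rw [← quotientPowMap_comp I hm hk, ← Ext.mk₀_comp_mk₀_assoc, ← hη,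
    ← Ext.comp_assoc_of_third_deg_zero, h', Ext.zero_comp]

lemma exists_comp_eq_zero {S : ShortComplex (ModuleCat.{u} R)} (hS : S.ShortExact)
    (h : ExtVanishes I i S.X₃) {n : ℕ}
    (ξ : Ext (ModuleCat.of R (R ⧸ I ^ n)) S.X₁ (i + 1))
    (hξ : ξ.comp (Ext.mk₀ S.f) (add_zero (i + 1)) = 0) :
    ∃ (m : ℕ) (h : n ≤ m), (Ext.mk₀ (quotientPowMap I h)).comp ξ (zero_add (i + 1)) = 0 := by
  obtain ⟨η, rfl⟩ := Ext.covariant_sequence_exact₁ _ hS ξ hξ rfl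
  obtain ⟨m, hm, h'⟩ := h n η
  refine ⟨m, hm, ?_⟩
  rw [← Ext.comp_assoc _ _ _ (zero_add i) rfl (by omega), h', Ext.zero_comp]

/-- The vanishing for `M` follows from the vanishing one degree below for the modules
`M / a ^ n M`, where `a ∈ I` is `M`-regular. -/
lemma succ_of_isSMulRegular {M : ModuleCat.{u} R} {a : R} (haI : a ∈ I) (ha : IsSMulRegular M a)
    (h : ∀ n : ℕ, ExtVanishes I i (M.smulShortComplex (a ^ n)).X₃) : ExtVanishes I (i + 1) M := by
  intro n ξ
  have hS := (ha.pow n).smulShortComplex_shortExact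
  have hξ : ξ.comp (Ext.mk₀ (M.smulShortComplex (a ^ n)).f) (add_zero (i + 1)) = 0 := by
    have h0 : a ^ n • 𝟙 (ModuleCat.of R (R ⧸ I ^ n)) = 0 := by
      refine ModuleCat.hom_ext (LinearMap.ext fun x => ?_)
      obtain ⟨x, rfl⟩ := Submodule.Quotient.mk_surjective _ x
      exact (Submodule.Quotient.mk_eq_zero _).2
        (show a ^ n • x ∈ _ from Ideal.mul_mem_right x _ (Ideal.pow_mem_pow haI n))
    rw [ModuleCat.smulShortComplex_f_eq_smul_id]
    refine (Ext.smul_eq_comp_mk₀ ξ (a ^ n)).symm.trans ?_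
    rw [← Ext.mk₀_id_comp ξ, ← Ext.smul_comp, ← Ext.mk₀_smul, h0, Ext.mk₀_zero, Ext.zero_comp]
    rfl
  exact exists_comp_eq_zero hS (h n) ξ hξ

lemma one_of_injective_of_isPowTorsion {S : ShortComplex (ModuleCat.{u} R)} (hS : S.ShortExact)
    [Injective S.X₂] (h₂ : Module.IsPowTorsion I S.X₂) : ExtVanishes I 1 S.X₁ := by
  intro n ξ
  obtain ⟨η, rfl⟩ := Ext.covariant_sequence_exact₁ _ hS ξ (Ext.eq_zero_of_injective _) (zero_add 1)
  obtain ⟨g, rfl⟩ : ∃ g, Ext.mk₀ g = η := ⟨_, Ext.mk₀_addEquiv₀_apply η⟩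
  obtain ⟨e, he⟩ := hS.moduleCat_surjective_g (g.hom (Submodule.Quotient.mk 1))
  obtain ⟨k, hk⟩ := h₂ e
  let l : ModuleCat.of R (R ⧸ I ^ (max n k)) ⟶ S.X₂ :=
    ModuleCat.ofHom (Submodule.liftQ _ (LinearMap.toSpanSingleton R S.X₂ e) fun r hr =>
      hk r (Ideal.pow_le_pow_right (le_max_right n k) hr))
  have hl : quotientPowMap I (le_max_left n k) ≫ g = l ≫ S.g := by
    refine ModuleCat.hom_ext (Submodule.linearMap_qext _ (LinearMap.ext_ring ?_))
    refine he.symm.trans (congrArg S.g ?_)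
    exact (one_smul R e).symm
  refine ⟨max n k, le_max_left n k, ?_⟩
  rw [← Ext.comp_assoc _ _ _ (zero_add 0) (zero_add 1) (by omega), Ext.mk₀_comp_mk₀, hl,
    ← Ext.mk₀_comp_mk₀, Ext.comp_assoc _ _ _ (zero_add 0) (zero_add 1) (by omega),
    hS.comp_extClass, Ext.comp_zero]

lemma succ_of_injective {S : ShortComplex (ModuleCat.{u} R)} (hS : S.ShortExact)
    [Injective S.X₂] (h : ExtVanishes I i S.X₃) : ExtVanishes I (i + 1) S.X₁ := fun _ ξ =>
  exists_comp_eq_zero hS h ξ (Ext.eq_zero_of_injective _)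

lemma exists_shortExact_injective_isPowTorsion [IsNoetherianRing R] (I : Ideal R)
    (M : ModuleCat.{u} R) (hM : Module.IsPowTorsion I M) :
    ∃ S : ShortComplex (ModuleCat.{u} R), S.ShortExact ∧ S.X₁ = M ∧ Injective S.X₂ ∧
      Module.IsPowTorsion I S.X₂ ∧ Module.IsPowTorsion I S.X₃ := by
  let E := Injective.under M
  have : Injective (ModuleCat.of R E) := inferInstanceAs (Injective (Injective.under M))
  have : Module.Injective R E := Module.injective_module_of_injective_object R E
  let ι : M →ₗ[R] Submodule.powTorsion I E := (Injective.ι M).hom.codRestrict _ fun x =>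
    (hM x).imp fun n hn r hr => by rw [← map_smul, hn r hr, map_zero]
  have hι : Function.Injective ι := fun x y hxy =>
    (ModuleCat.mono_iff_injective (Injective.ι M)).1 inferInstance (congrArg Subtype.val hxy)
  have htors := Module.IsPowTorsion.powTorsion I E
  refine ⟨ModuleCat.shortComplexOfCompEqZero ι (LinearMap.range ι).mkQ
    ι.exact_map_mkQ_range.linearMap_comp_eq_zero, ?_, rfl, ?_, htors,
    htors.of_surjective _ (Submodule.mkQ_surjective _)⟩
  · exact { exact := ModuleCat.shortComplex_exact _ ι.exact_map_mkQ_range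
            mono_f := (ModuleCat.mono_iff_injective _).2 hι
            epi_g := (ModuleCat.epi_iff_surjective _).2 (Submodule.mkQ_surjective _) }
  · have := Module.Injective.powTorsion I E
    exact Module.injective_object_of_injective_module R _

/-- Torsion modules have no higher local cohomology. -/
lemma succ_of_isPowTorsion [IsNoetherianRing R] (M : ModuleCat.{u} R)
    (hM : Module.IsPowTorsion I M) (i : ℕ) : ExtVanishes I (i + 1) M := by
  induction i generalizing M with
  | zero =>
    obtain ⟨S, hS, rfl, _, h₂, -⟩ := exists_shortExact_injective_isPowTorsion I M hM
    exact one_of_injective_of_isPowTorsion hS h₂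
  | succ i ih =>
    obtain ⟨S, hS, rfl, _, -, h₃⟩ := exists_shortExact_injective_isPowTorsion I M hM
    exact succ_of_injective hS (ih _ h₃)

lemma of_submodule {M : ModuleCat.{u} R} (N : Submodule R M)
    (h₁ : ExtVanishes I i (ModuleCat.of R N)) (h₃ : ExtVanishes I i (ModuleCat.of R (M ⧸ N))) :
    ExtVanishes I i M :=
  of_shortExact (S := ModuleCat.shortComplexOfCompEqZero N.subtype N.mkQ (by ext; simp))
    { exact := ModuleCat.shortComplex_exact _ (LinearMap.exact_subtype_mkQ N)
      mono_f := (ModuleCat.mono_iff_injective _).2 N.injective_subtype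
      epi_g := (ModuleCat.epi_iff_surjective _).2 N.mkQ_surjective } h₁ h₃

/-- Local cohomology of a `J`-torsion module vanishes above `dim R / J`. -/
theorem of_isPowTorsion [IsNoetherianRing R] (J : Ideal R) (M : ModuleCat.{u} R)
    (hM : Module.IsPowTorsion J M) (i : ℕ) (hi : ringKrullDim (R ⧸ J) < i) :
    ExtVanishes I i M := by
  induction J using IsNoetherian.induction generalizing M i with
  | hgt J ih =>
  have dim_mono {K : Ideal R} (h : J ≤ K) : ringKrullDim (R ⧸ K) ≤ ringKrullDim (R ⧸ J) :=
    ringKrullDim_le_of_surjective (Ideal.Quotient.factor h) (Ideal.Quotient.factor_surjective h)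
  by_cases htop : J = ⊤
  · subst htop
    have := hM.subsingleton_of_top
    exact of_subsingleton M
  by_cases hprime : Ideal.IsPrime J
  · obtain ⟨i, rfl⟩ : ∃ k, i = k + 1 := by
      refine Nat.exists_eq_add_one_of_ne_zero ?_
      rintro rfl
      have := Ideal.Quotient.nontrivial_iff.2 htop
      exact absurd hi (not_lt.2 ringKrullDim_nonneg_of_nontrivial)
    by_cases hIJ : I ≤ J
    · exact succ_of_isPowTorsion M (hM.of_le hIJ) i
    · obtain ⟨a, haI, haJ⟩ := SetLike.not_le_iff_exists.1 hIJ
      have hlt : J < J ⊔ Ideal.span {a} := left_lt_sup.2 (by simpa using haJ)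
      have hN := hM.of_surjective _ (Submodule.powTorsion (Ideal.span {a}) M).mkQ_surjective
      refine of_submodule (Submodule.powTorsion (Ideal.span {a}) M)
        (ih _ hlt _ (hM.powTorsion_span_singleton a) _ ((dim_mono hlt.le).trans_lt hi))
        (succ_of_isSMulRegular haI
          (Submodule.isSMulRegular_quotient_powTorsion_span_singleton a) fun n =>
          ih _ hlt _ ?_ i ?_)
      · refine (hN.of_surjective _ (Submodule.mkQ_surjective _)).sup_span_singleton (n := n) ?_
        intro y
        obtain ⟨x, rfl⟩ := Submodule.Quotient.mk_surjective _ y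
        exact (Submodule.Quotient.mk_eq_zero _).2
          (Submodule.smul_mem_pointwise_smul x (a ^ n) ⊤ Submodule.mem_top)
      · have := (ringKrullDim_quotient_sup_span_singleton_add_one_le haJ).trans_lt hi
        push_cast at this
        exact lt_of_add_lt_add_right this
  · obtain ⟨a, ha, b, hb, hab⟩ := (Ideal.not_isPrime_iff.1 hprime).resolve_left htop
    have hla : J < J ⊔ Ideal.span {a} := left_lt_sup.2 (by simpa using ha)
    have hlb : J < J ⊔ Ideal.span {b} := left_lt_sup.2 (by simpa using hb)
    have hmul : (J ⊔ Ideal.span {a}) * (J ⊔ Ideal.span {b}) ≤ J := by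
      rw [Ideal.sup_mul, Ideal.mul_sup (Ideal.span {a}), Ideal.span_singleton_mul_span_singleton]
      exact sup_le Ideal.mul_le_left (sup_le Ideal.mul_le_right
        ((Ideal.span_singleton_le_iff_mem _).2 hab))
    exact of_submodule (Submodule.powTorsion (J ⊔ Ideal.span {a}) M)
      (ih _ hla _ (Module.IsPowTorsion.powTorsion _ _) i ((dim_mono hla.le).trans_lt hi))
      (ih _ hlb _ (hM.quotient_powTorsion hmul) i ((dim_mono hlb.le).trans_lt hi))

end ExtVanishes

/-- A class `x` in `Ext`, computed as a derived functor, is represented by a class `ξ` in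
`Abelian.Ext` such that `x` dies under every morphism killing `ξ`. -/
lemma exists_ext_class {C : Type*} [Category.{u} C] [Abelian C] [Linear R C] [EnoughProjectives C]
    [HasExt.{u} C] {B Y : C} {i : ℕ} (x : ((Ext R C (i + 1)).obj (op B)).obj Y) :
    ∃ ξ : Abelian.Ext B Y (i + 1), ∀ {A : C} (f : A ⟶ B),
      (Abelian.Ext.mk₀ f).comp ξ (zero_add (i + 1)) = 0 →
        ((Ext R C (i + 1)).map f.op).app Y x = 0 := by
  let F := ((linearYoneda R C).obj Y).rightOp
  let Q := projectiveResolution B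
  let K := (F.mapHomologicalComplex (ComplexShape.down ℕ)).obj Q.complex
  let isoB : (F.leftDerived (i + 1)).obj B ≅ K.homology (i + 1) := Q.isoLeftDerivedObj F (i + 1)
  have : Mono (isoB.hom ≫ K.homologyι (i + 1)) := mono_comp _ _
  have : Epi (isoB.hom ≫ K.homologyι (i + 1)).unop := unop_epi_of_mono _
  obtain ⟨z, hz⟩ : ∃ z : (K.opcycles (i + 1)).unop,
      (isoB.hom ≫ K.homologyι (i + 1)).unop z = x :=
    (ModuleCat.epi_iff_surjective (isoB.hom ≫ K.homologyι (i + 1)).unop).1 inferInstance x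
  let c : Q.complex.X (i + 1) ⟶ Y := (K.pOpcycles (i + 1)).unop z
  have hc : Q.complex.d (i + 2) (i + 1) ≫ c = 0 := by
    have := K.d_pOpcycles (i + 2) (i + 1)
    exact ConcreteCategory.congr_hom (congrArg Quiver.Hom.unop this) z
  refine ⟨Q.extMk c (i + 2) rfl hc, fun {A} f h => ?_⟩
  let P := projectiveResolution A
  let L := (F.mapHomologicalComplex (ComplexShape.down ℕ)).obj P.complex
  let isoA : (F.leftDerived (i + 1)).obj A ≅ L.homology (i + 1) := P.isoLeftDerivedObj F (i + 1)
  let φ : ProjectiveResolution.Hom P Q f :=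
    { hom := ProjectiveResolution.lift f P Q
      hom_f_zero_comp_π_f_zero :=
        (ProjectiveResolution.lift_commutes_zero f P Q).trans (by simp) }
  let ψ : L ⟶ K := (F.mapHomologicalComplex (ComplexShape.down ℕ)).map φ.hom
  rw [ProjectiveResolution.mk₀_comp_extMk c _ rfl hc φ,
    ProjectiveResolution.extMk_eq_zero_iff _ _ _ _ _ i rfl] at h
  obtain ⟨g, hg⟩ := h
  have hz' : (HomologicalComplex.opcyclesMap ψ (i + 1)).unop z =
      (L.fromOpcycles (i + 1) i).unop g := by
    refine (ModuleCat.mono_iff_injective (L.pOpcycles (i + 1)).unop).1 inferInstance ?_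
    refine (ConcreteCategory.congr_hom (congrArg Quiver.Hom.unop
      (HomologicalComplex.p_opcyclesMap ψ (i + 1))) z).trans ?_
    refine Eq.trans ?_ (ConcreteCategory.congr_hom (congrArg Quiver.Hom.unop
      (L.p_fromOpcycles (i + 1) i)) g).symm
    exact hg.symm
  have key : (F.leftDerived (i + 1)).map f ≫ isoB.hom ≫ K.homologyι (i + 1) =
      isoA.hom ≫ L.homologyι (i + 1) ≫ HomologicalComplex.opcyclesMap ψ (i + 1) := by
    have : (F.leftDerived (i + 1)).map f ≫ isoB.hom =
        isoA.hom ≫ HomologicalComplex.homologyMap ψ (i + 1) :=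
      ProjectiveResolution.isoLeftDerivedObj_hom_naturality f P Q φ.hom
      (ProjectiveResolution.lift_commutes_zero f P Q) F (i + 1)
    rw [← Category.assoc, this, Category.assoc]
    congr 1
    exact HomologicalComplex.homologyι_naturality ψ (i + 1)
  subst hz
  refine (ConcreteCategory.congr_hom (congrArg Quiver.Hom.unop key) z).trans ?_
  change (isoA.hom.unop) ((L.homologyι (i + 1)).unop
    ((HomologicalComplex.opcyclesMap ψ (i + 1)).unop z)) = 0
  rw [hz']
  have h0 := ConcreteCategory.congr_hom (congrArg Quiver.Hom.unop
    (L.homologyι_comp_fromOpcycles (i + 1) i)) g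
  refine (congrArg isoA.hom.unop h0).trans ?_
  exact map_zero isoA.hom.unop.hom

lemma ExtVanishes.subsingleton_localCohomology {R : Type} [CommRing R] {I : Ideal R} {i : ℕ}
    {M : ModuleCat.{0} R} (h : ExtVanishes I (i + 1) M) :
    Subsingleton ((localCohomology I (i + 1)).obj M) := by
  refine subsingleton_of_forall_eq 0 fun x => ?_
  let D := localCohomology.diagram (localCohomology.idealPowersDiagram I) (i + 1)
  have hcol := isColimitOfPreserves ((evaluation _ _).obj M) (colimit.isColimit D)
  obtain ⟨j, y, rfl⟩ := Concrete.isColimit_exists_rep _ hcol x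
  obtain ⟨ξ, hξ⟩ := exists_ext_class y
  obtain ⟨m, hm, h0⟩ := h _ ξ
  have hy := hξ _ h0
  let t : j ⟶ op (op m) := (homOfLE hm).op.op
  have ht := ConcreteCategory.congr_hom
    ((((evaluation _ _).obj M).mapCocone (colimit.cocone D)).w t) y
  refine ht.symm.trans ?_
  refine (congrArg _ hy).trans ?_
  exact map_zero ((((evaluation _ _).obj M).mapCocone (colimit.cocone D)).ι.app (op (op m))).hom

end LocalCohomology

/-- Grothendieck vanishing: over a commutative Noetherian ring of Krull dimension `d`,
local cohomology `H^i_I(M)` vanishes for `i > d`. -/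
theorem stmt8 (R : Type) [CommRing R] [IsNoetherianRing R] (I : Ideal R) (d : ℕ)
    (hd : ringKrullDim R = d)
    (M : Type) [AddCommGroup M] [Module R M] :
    ∀ i : ℕ, d < i → Subsingleton ((localCohomology I i).obj (ModuleCat.of R M)) := by
  intro i hi
  obtain ⟨i, rfl⟩ := Nat.exists_eq_add_one_of_ne_zero (Nat.ne_zero_of_lt hi)
  refine (LocalCohomology.ExtVanishes.of_isPowTorsion ⊥ (ModuleCat.of R M)
    Module.IsPowTorsion.bot (i + 1) ?_).subsingleton_localCohomology
  rw [ringKrullDim_eq_of_ringEquiv (RingEquiv.quotientBot R), hd]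
  exact_mod_cast hi
end

section
/- Let R be a commutative Noetherian ring, I an ideal, M a finitely generated R-module with IM ≠ M, and e = depth_I(M) the length of a maximal M-regular sequence in I. Then H^i_I(M) = 0 for i < e and H^e_I(M) ≠ 0. -/
namespace CategoryTheory

namespace ShortComplex

lemma moduleCat_homologyπ_eq_zero_iff {R : Type*} [Ring R] (S : ShortComplex (ModuleCat R))
    (x : S.cycles) : S.homologyπ x = 0 ↔ ∃ y, S.f y = S.iCycles x := by
  have h := S.moduleCat_pOpcycles_eq_zero_iff (S.iCycles x)
  rw [← ConcreteCategory.comp_apply, ← S.homology_π_ι, ConcreteCategory.comp_apply] at h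
  refine Iff.trans ?_ h
  exact (map_eq_zero_iff S.homologyι.hom ((ModuleCat.mono_iff_injective _).1 inferInstance)).symm

lemma mono_homologyMap_of_moduleCat {R : Type*} [Ring R] {S₁ S₂ : ShortComplex (ModuleCat R)}
    (φ : S₁ ⟶ S₂)
    (h : ∀ x : S₁.X₂, S₁.g x = 0 → ∀ y : S₂.X₁, S₂.f y = φ.τ₂ x → ∃ z : S₁.X₁, S₁.f z = x) :
    Mono (homologyMap φ) := by
  rw [ModuleCat.mono_iff_injective]
  change Function.Injective (homologyMap φ).hom
  rw [injective_iff_map_eq_zero]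
  intro a ha
  obtain ⟨b, rfl⟩ := (ModuleCat.epi_iff_surjective S₁.homologyπ).1 inferInstance a
  change (homologyMap φ) _ = 0 at ha
  rw [← ConcreteCategory.comp_apply, homologyπ_naturality, ConcreteCategory.comp_apply,
    moduleCat_homologyπ_eq_zero_iff] at ha
  obtain ⟨y, hy⟩ := ha
  rw [← ConcreteCategory.comp_apply, cyclesMap_i, ConcreteCategory.comp_apply] at hy
  rw [moduleCat_homologyπ_eq_zero_iff]
  refine h _ ?_ y hy
  rw [← ConcreteCategory.comp_apply, iCycles_g]
  rfl

lemma epi_homologyMap_of_moduleCat_unop {R : Type*} [Ring R]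
    {S₁ S₂ : ShortComplex (ModuleCat R)ᵒᵖ} (φ : S₁ ⟶ S₂)
    (h : ∀ x : S₂.X₂.unop, S₂.f.unop x = 0 → ∀ y : S₁.X₃.unop, S₁.g.unop y = φ.τ₂.unop x →
      ∃ z : S₂.X₃.unop, S₂.g.unop z = x) :
    Epi (homologyMap φ) := by
  have := mono_homologyMap_of_moduleCat (unopMap φ) h
  have e := homologyOpIso_hom_naturality (unopMap φ)
  have : Epi (homologyMap (opMap (unopMap φ)) ≫ S₂.unop.homologyOpIso.hom) := by
    rw [e]; infer_instance
  exact (epi_comp_iff_of_isIso (homologyMap (opMap (unopMap φ))) _).1 this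

end ShortComplex

namespace ProjectiveResolution

variable {C : Type*} [Category* C] [Abelian C] [HasExt C] {X Y : C} (P : ProjectiveResolution X)

lemma extMk_zero_eq_zero_iff (f : P.complex.X 0 ⟶ Y) (hf : P.complex.d 1 0 ≫ f = 0) :
    P.extMk f 1 rfl hf = 0 ↔ f = 0 := by
  refine ⟨fun h ↦ ?_, fun h ↦ by subst h; simp⟩
  rw [← P.extEquivCohomologyClass.apply_eq_iff_eq, extEquivCohomologyClass_extMk,
    extEquivCohomologyClass_zero, CochainComplex.HomComplex.CohomologyClass.mk_eq_zero_iff,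
    CochainComplex.HomComplex.Cocycle.toSingleMk_mem_coboundaries_iff _ _ _ _ _ 1 (by simp)] at h
  obtain ⟨g, hg⟩ := h
  have hz : Limits.IsZero (P.cochainComplex.X 1) :=
    P.cochainComplex.isZero_of_isStrictlyLE 0 1 (by simp)
  rw [hz.eq_of_src g 0, Limits.comp_zero] at hg
  rw [← cancel_epi (P.cochainComplexXIso (-(0 : ℕ)) 0 rfl).hom]
  simpa using! hg.symm

lemma extMk_eq_zero_iff_next {n : ℕ} (f : P.complex.X n ⟶ Y) (m : ℕ) (hm : n + 1 = m)
    (hf : P.complex.d m n ≫ f = 0) :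
    P.extMk f m hm hf = 0 ↔
      ∃ g : P.complex.X ((ComplexShape.down ℕ).next n) ⟶ Y, P.complex.d n _ ≫ g = f := by
  subst hm
  cases n with
  | zero =>
    rw [extMk_zero_eq_zero_iff]
    simp [eq_comm]
  | succ n =>
    rw [extMk_eq_zero_iff _ _ _ _ _ n rfl, ChainComplex.next_nat_succ]

end ProjectiveResolution

end CategoryTheory

section LeftDerivedExt

open CategoryTheory CategoryTheory.Abelian

variable {R : Type*} [CommRing R] {C : Type*} [Category* C] [Abelian C] [Linear R C]
  [EnoughProjectives C] [HasExt C]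

/-- If `g` induces an injection on `Abelian.Ext`, it induces a monomorphism on the left derived
`Ext`. -/
lemma mono_Ext_map {X X' : C} (g : X' ⟶ X) (Y : C) (n : ℕ)
    (hg : ∀ α : Abelian.Ext X Y n, (Abelian.Ext.mk₀ g).comp α (zero_add n) = 0 → α = 0) :
    Mono (((Ext R C n).map g.op).app Y) := by
  let P := ProjectiveResolution.of X
  let P' := ProjectiveResolution.of X'
  let φ : ProjectiveResolution.Hom P' P g := ⟨ProjectiveResolution.lift g P' P,
    HomologicalComplex.congr_hom (ProjectiveResolution.lift_commutes g P' P) 0⟩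
  let F := ((linearYoneda R C).obj Y).rightOp
  have : Epi ((F.mapHomologicalComplex _ ⋙
      HomologicalComplex.homologyFunctor _ _ n).map φ.hom) := by
    refine ShortComplex.epi_homologyMap_of_moduleCat_unop _ ?_
    intro x hx y hy
    change P.complex.X n ⟶ Y at x
    change P'.complex.X _ ⟶ Y at y
    change P.complex.d _ n ≫ x = 0 at hx
    change P'.complex.d n _ ≫ y = φ.hom.f n ≫ x at hy
    refine (P.extMk_eq_zero_iff_next x _ (ChainComplex.prev _ n).symm hx).1 (hg _ ?_)
    rw [ProjectiveResolution.mk₀_comp_extMk _ _ _ _ φ, P'.extMk_eq_zero_iff_next]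
    exact ⟨y, hy⟩
  have e := ProjectiveResolution.isoLeftDerivedObj_hom_naturality g P' P φ.hom
    (ProjectiveResolution.lift_commutes_zero g P' P) F n
  have : Epi ((F.leftDerived n).map g ≫ (P.isoLeftDerivedObj F n).hom) := by
    rw [e]; infer_instance
  have := (epi_comp_iff_of_isIso ((F.leftDerived n).map g) (P.isoLeftDerivedObj F n).hom).1 this
  exact inferInstanceAs (Mono ((F.leftDerived n).map g).unop)

/-- The left derived `Ext` vanishes exactly when `Abelian.Ext` does. -/
lemma isZero_Ext_iff (X Y : C) (n : ℕ) :
    Limits.IsZero (((Ext R C n).obj (Opposite.op X)).obj Y) ↔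
      Subsingleton (Abelian.Ext X Y n) := by
  let P := ProjectiveResolution.of X
  rw [(P.isoExt n Y).isZero_iff, ← HomologicalComplex.exactAt_iff_isZero_homology,
    HomologicalComplex.exactAt_iff, ShortComplex.moduleCat_exact_iff]
  refine ⟨fun h ↦ subsingleton_of_forall_eq 0 fun α ↦ ?_, fun _ x hx ↦ ?_⟩
  · obtain ⟨f, hf, rfl⟩ := P.extMk_surjective α _ (ChainComplex.prev _ n).symm
    rw [P.extMk_eq_zero_iff_next]
    exact h f hf
  · exact (P.extMk_eq_zero_iff_next x _ (ChainComplex.prev _ n).symm hx).1 (Subsingleton.elim _ _)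

end LeftDerivedExt

section ModuleExt

universe u

open RingTheory.Sequence CategoryTheory CategoryTheory.Abelian

variable {R : Type u} [CommRing R]

lemma ModuleCat.smul_ext_eq_zero {N M : ModuleCat.{u} R} {r : R} (hr : ∀ n : N, r • n = 0) {i : ℕ}
    (x : Abelian.Ext N M i) : r • x = 0 := by
  have h : r • 𝟙 N = 0 := by
    ext n
    exact hr n
  rw [← x.mk₀_id_comp, ← Ext.smul_comp, ← Ext.mk₀_smul, h, Ext.mk₀_zero, Ext.zero_comp]

lemma RingTheory.Sequence.IsWeaklyRegular.subsingleton_ext {rs : List R} {N M : ModuleCat.{u} R}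
    (hrs : IsWeaklyRegular M rs) (hN : ∀ r ∈ rs, ∃ k : ℕ, ∀ n : N, r ^ k • n = 0) (i : ℕ)
    (hi : i < rs.length) : Subsingleton (Abelian.Ext N M i) := by
  induction rs generalizing M i with
  | nil => simp at hi
  | cons r rs ih =>
    rw [isWeaklyRegular_cons_iff] at hrs
    obtain ⟨k, hk⟩ := hN r (by simp)
    have reg : IsSMulRegular (Abelian.Ext N M i) r := by
      rw [isSMulRegular_iff_right_eq_zero_of_smul]
      intro x hx
      have hS := hrs.1.smulShortComplex_shortExact
      rw [Ext.smul_eq_comp_mk₀] at hx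
      cases i with
      | zero =>
        have := hS.mono_f
        exact Ext.postcomp_mk₀_injective_of_mono N (M.smulShortComplex r).f
          (hx.trans (map_zero _).symm)
      | succ i =>
        obtain ⟨y, rfl⟩ := Ext.covariant_sequence_exact₁ N hS x hx rfl
        have := ih (M := ModuleCat.of R (QuotSMulTop r M)) hrs.2
          (fun s hs ↦ hN s (List.mem_cons_of_mem _ hs)) i (by simpa using hi)
        obtain rfl : y = 0 := @Subsingleton.elim _ this _ _
        exact Ext.zero_comp N i hS.extClass _ rfl
    refine subsingleton_of_forall_eq 0 fun x ↦ (reg.pow k) ?_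
    simp only [ModuleCat.smul_ext_eq_zero hk]

lemma RingTheory.Sequence.IsWeaklyRegular.subsingleton_linearMap_quotient {rs : List R}
    {N M : ModuleCat.{u} R} (hrs : IsWeaklyRegular M rs)
    (hN : ∀ r ∈ rs, ∃ k : ℕ, ∀ n : N, r ^ k • n = 0)
    (hext : Subsingleton (Abelian.Ext N M rs.length)) :
    Subsingleton (N →ₗ[R] M ⧸ Ideal.ofList rs • (⊤ : Submodule R M)) := by
  induction rs generalizing M with
  | nil =>
    have e : (M ⧸ Ideal.ofList ([] : List R) • (⊤ : Submodule R M)) ≃ₗ[R] M :=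
      Submodule.quotEquivOfEqBot _ (by simp)
    have : Subsingleton (N ⟶ M) := Ext.homEquiv₀.subsingleton_congr.mp hext
    have : Subsingleton (N →ₗ[R] M) := ModuleCat.homEquiv.symm.subsingleton_congr.mpr this
    exact (e.congrRight : (N →ₗ[R] _) ≃ₗ[R] _).toEquiv.subsingleton
  | cons r rs ih =>
    have hv := hrs.subsingleton_ext hN rs.length (by simp)
    rw [isWeaklyRegular_cons_iff] at hrs
    have hS := hrs.1.smulShortComplex_shortExact
    have : Subsingleton (N →ₗ[R] QuotSMulTop r M ⧸
        Ideal.ofList rs • (⊤ : Submodule R (QuotSMulTop r M))) := by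
      refine ih (M := ModuleCat.of R (QuotSMulTop r M)) hrs.2
        (fun s hs ↦ hN s (List.mem_cons_of_mem _ hs)) (subsingleton_of_forall_eq 0 fun x ↦ ?_)
      obtain ⟨y, rfl⟩ := Ext.covariant_sequence_exact₃ N hS x rfl
        (@Subsingleton.elim _ hext _ _)
      obtain rfl : y = 0 := @Subsingleton.elim _ hv _ _
      exact Ext.zero_comp N rs.length (Ext.mk₀ (M.smulShortComplex r).g) _ _
    exact ((Submodule.quotOfListConsSMulTopEquivQuotSMulTopInner M r rs).congrRight :
      (N →ₗ[R] _) ≃ₗ[R] _).toEquiv.subsingleton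

lemma RingTheory.Sequence.IsWeaklyRegular.eq_zero_of_mk₀_comp_eq_zero {rs : List R}
    {N' N M : ModuleCat.{u} R} (hrs : IsWeaklyRegular M rs)
    (hN : ∀ r ∈ rs, ∃ k : ℕ, ∀ n : N', r ^ k • n = 0) (g : N' ⟶ N) [Epi g]
    (x : Abelian.Ext N M rs.length)
    (hx : (Ext.mk₀ g).comp x (zero_add rs.length) = 0) : x = 0 := by
  obtain hl | ⟨l, hl⟩ : rs.length = 0 ∨ ∃ l, rs.length = l + 1 := by
    cases rs.length <;> simp
  · revert x
    rw [hl]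
    exact fun x hx ↦ Ext.precomp_mk₀_injective_of_epi M g (hx.trans (map_zero _).symm)
  · have hS := g.hom.shortExact_shortComplexKer ((ModuleCat.epi_iff_surjective g).1 inferInstance)
    obtain ⟨y, rfl⟩ := Ext.contravariant_sequence_exact₃ hS M x hx (n₀ := l) (by lia)
    have := hrs.subsingleton_ext (N := g.hom.shortComplexKer.X₁)
      (fun r hr ↦ (hN r hr).imp fun k hk n ↦ Subtype.ext (hk n.1)) l (by lia)
    rw [Subsingleton.elim y 0, Ext.comp_zero]

end ModuleExt

section LocalCohomology

universe u

open CategoryTheory CategoryTheory.Limits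

variable {R : Type u} [CommRing R]

instance ModuleCat.forget_preservesFilteredColimitsOfSize_zero :
    PreservesFilteredColimitsOfSize.{0, 0} (forget (ModuleCat.{u} R)) :=
  preservesFilteredColimitsOfSize_shrink.{0, u, 0, u} _

/-- The local cohomology of `M` is the colimit of `Ext (R ⧸ I ^ t) M`. -/
noncomputable def localCohomology.isColimitObj (I : Ideal R) (i : ℕ) (M : ModuleCat.{u} R) :
    IsColimit (((evaluation (ModuleCat.{u} R) (ModuleCat.{u} R)).obj M).mapCocone
      (colimit.cocone (diagram (idealPowersDiagram I) i))) :=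
  isColimitOfPreserves _ (colimit.isColimit _)

lemma localCohomology.subsingleton_obj (I : Ideal R) (i : ℕ) (M : ModuleCat.{u} R)
    (h : ∀ t : ℕ, Subsingleton (Abelian.Ext (ModuleCat.of R (R ⧸ I ^ t)) M i)) :
    Subsingleton ((localCohomology I i).obj M) := by
  refine subsingleton_of_forall_eq 0 fun x ↦ ?_
  obtain ⟨j, y, rfl⟩ := Concrete.isColimit_exists_rep _ (isColimitObj I i M) x
  have := (isZero_Ext_iff (R := R) (ModuleCat.of R (R ⧸ I ^ j.unop.unop)) M i).2 (h _)
  have := ModuleCat.subsingleton_of_isZero this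
  obtain rfl : y = 0 := @Subsingleton.elim _ this _ _
  exact map_zero (((evaluation _ _).obj M).map
    (colimit.ι (diagram (idealPowersDiagram I) i) j)).hom

lemma localCohomology.nontrivial_obj (I : Ideal R) (i : ℕ) (M : ModuleCat.{u} R)
    (hinj : ∀ (s t : ℕ) (g : ModuleCat.of R (R ⧸ I ^ t) ⟶ ModuleCat.of R (R ⧸ I ^ s)) [Epi g]
      (x : Abelian.Ext (ModuleCat.of R (R ⧸ I ^ s)) M i),
      (Abelian.Ext.mk₀ g).comp x (zero_add i) = 0 → x = 0)
    (t : ℕ) (ht : Nontrivial (Abelian.Ext (ModuleCat.of R (R ⧸ I ^ t)) M i)) :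
    Nontrivial ((localCohomology I i).obj M) := by
  by_contra hsub
  rw [not_nontrivial_iff_subsingleton] at hsub
  refine not_subsingleton_iff_nontrivial.2 ht ((isZero_Ext_iff (R := R) _ M i).1 ?_)
  let D := diagram (idealPowersDiagram I) i ⋙ (evaluation (ModuleCat.{u} R) (ModuleCat.{u} R)).obj M
  let j : (ℕᵒᵖ)ᵒᵖ := Opposite.op (Opposite.op t)
  have hz (x : D.obj j) : x = 0 := by
    obtain ⟨k, f, g, hfg⟩ := Concrete.isColimit_exists_of_rep_eq D (isColimitObj I i M) x
      (0 : D.obj j) (@Subsingleton.elim _ hsub _ _)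
    have hm (f : j ⟶ k) : Mono (D.map f) := by
      have : Epi ((ringModIdeals (idealPowersDiagram I)).map f.unop) := by
        rw [ModuleCat.epi_iff_surjective]
        intro y
        obtain ⟨y, rfl⟩ := Ideal.Quotient.mk_surjective y
        exact ⟨Ideal.Quotient.mk _ y, rfl⟩
      exact mono_Ext_map _ M i (@hinj _ _ _ this)
    obtain rfl : f = g := Subsingleton.elim _ _
    exact (ModuleCat.mono_iff_injective _).1 (hm f) hfg
  have : Subsingleton (D.obj j) := subsingleton_of_forall_eq 0 hz
  exact ModuleCat.isZero_of_subsingleton (D.obj j)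

end LocalCohomology

open RingTheory.Sequence

/-- Grothendieck non-vanishing/vanishing in terms of depth: if `e = depth_I(M)` (witnessed by
a maximal `M`-regular sequence in `I` of length `e`), then `H^i_I(M) = 0` for `i < e` and
`H^e_I(M) ≠ 0`. -/
theorem stmt9 (R : Type) [CommRing R] [IsNoetherianRing R] (I : Ideal R)
    (M : Type) [AddCommGroup M] [Module R M] [Module.Finite R M]
    (hIM : I • (⊤ : Submodule R M) ≠ ⊤)
    (e : ℕ) (rs : List R) (hrs : ∀ r ∈ rs, r ∈ I) (hreg : IsRegular M rs)
    (hlen : rs.length = e)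
    (hmax : ∀ x ∈ I, ¬ IsRegular M (rs ++ [x])) :
    (∀ i : ℕ, i < e → Subsingleton ((localCohomology I i).obj (ModuleCat.of R M))) ∧
    Nontrivial ((localCohomology I e).obj (ModuleCat.of R M)) := by
  subst hlen
  have hw : IsWeaklyRegular (ModuleCat.of R M) rs := hreg.toIsWeaklyRegular
  have hN (t : ℕ) : ∀ r ∈ rs, ∃ k : ℕ, ∀ n : ModuleCat.of R (R ⧸ I ^ t), r ^ k • n = 0 := by
    refine fun r hr ↦ ⟨t, fun n ↦ ?_⟩
    obtain ⟨n, rfl⟩ := Ideal.Quotient.mk_surjective n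
    exact Ideal.Quotient.eq_zero_iff_mem.2
      (Ideal.mul_mem_right _ _ (Ideal.pow_mem_pow (hrs r hr) t))
  refine ⟨fun i hi ↦ localCohomology.subsingleton_obj I i _ fun t ↦ hw.subsingleton_ext (hN t) i hi,
    localCohomology.nontrivial_obj I _ _
      (fun s t g _ x hx ↦ hw.eq_zero_of_mk₀_comp_eq_zero (hN t) g x hx) 1 ?_⟩
  rw [← not_subsingleton_iff_nontrivial]
  intro hsub
  obtain ⟨r, hr, hrM⟩ := IsSMulRegular.subsingleton_linearMap_iff.1
    (hw.subsingleton_linearMap_quotient (hN 1) hsub)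
  have hrI : r ∈ I := by simpa [Ideal.annihilator_quotient] using hr
  refine hmax r hrI ⟨(isWeaklyRegular_append_iff _ _ _).2
    ⟨hw, (isWeaklyRegular_singleton_iff _ _).2 hrM⟩, fun h ↦ hIM (top_le_iff.1 ?_)⟩
  refine h.le.trans (Submodule.smul_mono_left (Ideal.span_le.2 fun x hx ↦ ?_))
  simp only [Set.mem_ofPred_eq, List.mem_append, List.mem_singleton] at hx
  exact hx.elim (hrs x) (fun h ↦ h ▸ hrI)
end

section
/- Let R be a commutative Noetherian local ring with maximal ideal 𝔪 and residue field k. Then k is a perfect complex (small object) in the derived category D(R), i.e. isomorphic to a bounded complex of finitely generated projectives, if and only if R is regular. -/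
open CategoryTheory IsLocalRing Limits

universe w u

lemma IsLocalRing.exists_span_insert_erase_eq_maximalIdeal {R : Type u} [CommRing R] [IsLocalRing R]
    [DecidableEq R] {s : Finset R} (hs : Ideal.span (s : Set R) = maximalIdeal R) {x : R}
    (hx : x ∈ maximalIdeal R) (hx2 : x ∉ maximalIdeal R ^ 2) :
    ∃ i ∈ s, Ideal.span (insert x (s.erase i) : Set R) = maximalIdeal R := by
  have hx' := hx
  rw [← hs] at hx'
  obtain ⟨f, -, hf⟩ := Submodule.mem_span_finset.1 hx'
  have hmem : ∀ a ∈ s, a ∈ maximalIdeal R := fun a ha ↦ hs ▸ Ideal.subset_span ha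
  obtain ⟨i, hi, hu⟩ : ∃ i ∈ s, f i ∉ maximalIdeal R := by
    by_contra! h
    refine hx2 (hf ▸ Ideal.sum_mem _ fun a ha ↦ ?_)
    rw [pow_two]
    exact Ideal.mul_mem_mul (h a ha) (hmem a ha)
  refine ⟨i, hi, le_antisymm ?_ ?_⟩
  · rw [Ideal.span_le]
    rintro y (rfl | hy)
    · exact hx
    · exact hmem y (Finset.mem_of_mem_erase hy)
  · rw [← hs, Ideal.span_le]
    intro y hy
    by_cases hyi : y = i
    · subst hyi
      have hu : IsUnit (f y) := by simpa using hu
      rw [SetLike.mem_coe, ← Ideal.unit_mul_mem_iff_mem _ hu]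
      rw [← Finset.add_sum_erase _ _ hi, smul_eq_mul] at hf
      rw [eq_sub_of_add_eq hf]
      refine Ideal.sub_mem _ (Ideal.subset_span (Set.mem_insert _ _)) (Ideal.sum_mem _ fun a ha ↦ ?_)
      exact Ideal.mul_mem_left _ _ (Ideal.subset_span (Set.mem_insert_of_mem _ ha))
    · exact Ideal.subset_span (Set.mem_insert_of_mem _ (by simp [hyi]; exact hy))

lemma IsLocalRing.exists_span_maximalIdeal_quotient {R : Type u} [CommRing R] [IsLocalRing R]
    {x : R} [IsLocalRing (R ⧸ Ideal.span {x})] {t : Finset R}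
    (ht : Ideal.span (insert x t : Set R) = maximalIdeal R) :
    ∃ t' : Finset (R ⧸ Ideal.span {x}), t'.card ≤ t.card ∧
      Ideal.span (t' : Set (R ⧸ Ideal.span {x})) = maximalIdeal (R ⧸ Ideal.span {x}) := by
  classical
  refine ⟨t.image (Ideal.Quotient.mk (Ideal.span {x})), Finset.card_image_le, ?_⟩
  rw [← IsLocalRing.map_maximalIdeal_of_surjective _ Ideal.Quotient.mk_surjective, ← ht,
    Ideal.map_span, Set.image_insert_eq, Finset.coe_image,
    Ideal.Quotient.eq_zero_iff_mem.2 (Ideal.mem_span_singleton_self x), Ideal.span_insert_zero]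

lemma IsLocalRing.isLocalRing_quotient_span_singleton {R : Type u} [CommRing R] [IsLocalRing R]
    {x : R} (hx : x ∈ maximalIdeal R) : IsLocalRing (R ⧸ Ideal.span {x}) := by
  have : Nontrivial (R ⧸ Ideal.span {x}) := Ideal.Quotient.nontrivial_iff.2 fun h ↦
    (mem_maximalIdeal x).1 hx (Ideal.span_singleton_eq_top.1 h)
  exact .of_surjective' _ Ideal.Quotient.mk_surjective

lemma IsLocalRing.le_ringKrullDim_quotient_span_singleton {R : Type u} [CommRing R] [IsLocalRing R]
    [IsNoetherianRing R] {x : R} (hx : x ∈ maximalIdeal R) {d : ℕ}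
    (hd : ((d + 1 : ℕ) : WithBot ℕ∞) ≤ ringKrullDim R) :
    (d : WithBot ℕ∞) ≤ ringKrullDim (R ⧸ Ideal.span {x}) := by
  classical
  have h := ringKrullDim_le_ringKrullDim_quotient_add_card {x}
    (by simpa [IsLocalRing.ringJacobson_eq_maximalIdeal] using hx)
  rw [Finset.coe_singleton] at h
  have := hd.trans h
  simp only [Nat.cast_add, Nat.cast_one, Finset.card_singleton] at this
  exact ENat.WithBot.add_le_add_one_right_iff.1 this

lemma IsLocalRing.exists_mem_maximalIdeal_notMem_sq {R : Type u} [CommRing R] [IsLocalRing R]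
    [IsNoetherianRing R] (hR : maximalIdeal R ≠ ⊥) {S : Set (Ideal R)} (hfin : S.Finite)
    (hS : ∀ p ∈ S, p.IsPrime) (hm : maximalIdeal R ∉ S) :
    ∃ x ∈ maximalIdeal R, x ∉ maximalIdeal R ^ 2 ∧ ∀ p ∈ S, x ∉ p := by
  by_contra! h
  have := (Ideal.subset_union_prime_finite (hfin.insert (maximalIdeal R ^ 2)) (f := id)
    (maximalIdeal R ^ 2) (maximalIdeal R ^ 2) (I := maximalIdeal R) (by
      rintro i (rfl | hi) h
      · exact absurd rfl h
      · exact fun _ ↦ hS _ hi)).1 (by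
      intro x hx
      by_cases hx2 : x ∈ maximalIdeal R ^ 2
      · exact Set.mem_biUnion (Set.mem_insert _ _) hx2
      · obtain ⟨p, hp, hxp⟩ := h x hx hx2
        exact Set.mem_biUnion (Set.mem_insert_of_mem _ hp) hxp)
  obtain ⟨p, rfl | hp, hle⟩ := this
  · refine hR (Submodule.eq_bot_of_le_smul_of_le_jacobson_bot (maximalIdeal R) _
      (IsNoetherian.noetherian _) ?_ (IsLocalRing.maximalIdeal_le_jacobson _))
    rwa [id, pow_two] at hle
  · have := hS p hp
    exact hm (((maximalIdeal.isMaximal R).eq_of_le this.ne_top hle) ▸ hp)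

theorem IsLocalRing.isDomain_of_card_le_ringKrullDim (d : ℕ) : ∀ (R : Type u) [CommRing R]
    [IsLocalRing R] [IsNoetherianRing R] (s : Finset R),
    Ideal.span (s : Set R) = maximalIdeal R → s.card ≤ d → (s.card : WithBot ℕ∞) ≤ ringKrullDim R →
    IsDomain R := by
  classical
  induction d with
  | zero =>
    intro R _ _ _ s hs hd _
    obtain rfl : s = ∅ := by simpa using hd
    have : IsField R := IsLocalRing.isField_iff_maximalIdeal_eq.2 (by simpa using hs.symm)
    exact this.isDomain
  | succ d ih =>
    intro R _ _ _ s hs hd hdim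
    by_cases hR : maximalIdeal R = ⊥
    · exact (IsLocalRing.isField_iff_maximalIdeal_eq.2 hR).isDomain
    have hpos : 1 ≤ s.card := by
      rw [Nat.one_le_iff_ne_zero, Ne, Finset.card_eq_zero]
      rintro rfl
      exact hR (by simpa using hs.symm)
    obtain ⟨x, hx, hx2, hmin⟩ := IsLocalRing.exists_mem_maximalIdeal_notMem_sq hR
      (minimalPrimes.finite_of_isNoetherianRing R) (fun p hp ↦ Ideal.IsMinimalPrime.isPrime hp)
      (by
        intro hm
        rw [← IsLocalRing.maximalIdeal_height_eq_ringKrullDim,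
          Ideal.height_eq_zero_iff.2 hm] at hdim
        have : s.card ≤ 0 := by exact_mod_cast hdim
        omega)
    obtain ⟨i, hi, hspan⟩ := exists_span_insert_erase_eq_maximalIdeal hs hx hx2
    have := isLocalRing_quotient_span_singleton hx
    obtain ⟨t, htc, ht⟩ := exists_span_maximalIdeal_quotient hspan
    rw [Finset.card_erase_of_mem hi] at htc
    have hdim' := le_ringKrullDim_quotient_span_singleton hx (d := s.card - 1)
      (by rwa [Nat.sub_add_cancel hpos])
    have hdom := ih (R ⧸ Ideal.span {x}) t ht (by omega)
      (le_trans (by exact_mod_cast htc) hdim')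
    have hprime := (Ideal.Quotient.isDomain_iff_prime _).1 hdom
    obtain ⟨q, hq, hqx⟩ := Ideal.exists_minimalPrimes_le (bot_le : ⊥ ≤ Ideal.span {x})
    have hqp := Ideal.IsMinimalPrime.isPrime hq
    have hqbot : q = ⊥ := by
      refine Submodule.eq_bot_of_le_smul_of_le_jacobson_bot (maximalIdeal R) _
        (IsNoetherian.noetherian _) (fun y hy ↦ ?_) (IsLocalRing.maximalIdeal_le_jacobson _)
      obtain ⟨r, rfl⟩ := Ideal.mem_span_singleton'.1 (hqx hy)
      rw [mul_comm]
      exact Ideal.mul_mem_mul hx ((hqp.mem_or_mem hy).resolve_right (hmin q hq))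
    subst hqbot
    exact IsDomain.of_bot_isPrime R

theorem IsLocalRing.isWeaklyRegular_of_length_le_ringKrullDim (d : ℕ) : ∀ (R : Type u) [CommRing R]
    [IsLocalRing R] [IsNoetherianRing R] (rs : List R),
    Ideal.ofList rs = maximalIdeal R → rs.length = d → (d : WithBot ℕ∞) ≤ ringKrullDim R →
    RingTheory.Sequence.IsWeaklyRegular R rs := by
  classical
  induction d with
  | zero =>
    intro R _ _ _ rs hs hd _
    obtain rfl : rs = [] := by simpa using hd
    simp
  | succ d ih =>
    rintro R _ _ _ (_ | ⟨x, rs⟩) hs hd hdim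
    · simp
    have hx : x ∈ maximalIdeal R := by
      rw [← hs]; exact Ideal.subset_span (by simp)
    have := isLocalRing_quotient_span_singleton hx
    have hlen : rs.length = d := by simpa using hd
    have hdim' := le_ringKrullDim_quotient_span_singleton hx hdim
    rw [RingTheory.Sequence.isWeaklyRegular_cons_iff]
    have hdom : IsDomain R := isDomain_of_card_le_ringKrullDim (d + 1) R (x :: rs).toFinset
      (by rw [← hs, Ideal.ofList]; congr; ext; simp)
      ((List.toFinset_card_le _).trans hd.le)
      (le_trans (by exact_mod_cast (List.toFinset_card_le _).trans hd.le) hdim)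
    refine ⟨?_, ?_⟩
    · have hx0 : x ≠ 0 := by
        rintro rfl
        have hspan : Ideal.span (rs.toFinset : Set R) = maximalIdeal R := by
          rw [← hs, Ideal.ofList_cons, Ideal.span_singleton_zero, bot_sup_eq, Ideal.ofList]
          congr
          ext
          simp
        have h1 := Submodule.spanFinrank_span_le_ncard_of_finite (R := R) rs.toFinset.finite_toSet
        rw [← Ideal.span, hspan, Set.ncard_coe_finset] at h1
        have h2 := hdim.trans (ringKrullDim_le_spanFinrank_maximalIdeal R)
        have h3 : d + 1 ≤ (maximalIdeal R).spanFinrank := by exact_mod_cast h2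
        have := List.toFinset_card_le rs
        omega
      exact fun a b h ↦ mul_left_cancel₀ hx0 h
    · have e : QuotSMulTop x R ≃ₗ[R] R ⧸ Ideal.span {x} :=
        Submodule.quotEquivOfEq _ _ (by simp [← Submodule.ideal_span_singleton_smul])
      rw [e.isWeaklyRegular_congr,
        ← RingTheory.Sequence.isWeaklyRegular_map_algebraMap_iff (R ⧸ Ideal.span {x})]
      refine ih _ _ ?_ (by simpa using hlen) hdim'
      rw [← Ideal.map_ofList, ← map_maximalIdeal_of_surjective _ Ideal.Quotient.mk_surjective, ← hs,
        Ideal.ofList_cons, Ideal.map_sup, Ideal.Quotient.algebraMap_eq, Ideal.map_quotient_self,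
        bot_sup_eq]

lemma ModuleCat.hasProjectiveDimensionLT_ker_iff {R : Type u} [CommRing R] {P M : Type u}
    [AddCommGroup P] [Module R P] [Module.Projective R P] [AddCommGroup M] [Module R M]
    {f : P →ₗ[R] M} (hf : Function.Surjective f) (n : ℕ) :
    HasProjectiveDimensionLT (ModuleCat.of R M) (n + 2) ↔
      HasProjectiveDimensionLT (ModuleCat.of R (LinearMap.ker f)) (n + 1) :=
  (LinearMap.shortExact_shortComplexKer hf).hasProjectiveDimensionLT_X₃_iff n
    (inferInstanceAs (Projective (ModuleCat.of R P)))

lemma ModuleCat.hasProjectiveDimensionLT_one_iff {R : Type u} [CommRing R] {M : Type u}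
    [AddCommGroup M] [Module R M] :
    HasProjectiveDimensionLT (ModuleCat.of R M) 1 ↔ Module.Projective R M := by
  rw [← projective_iff_hasProjectiveDimensionLT_one, ← IsProjective.iff_projective]

instance {R : Type u} [CommRing R] {M : Type u} [AddCommGroup M] [Module R M]
    [Module.Projective R M] (x : R) : Module.Projective (R ⧸ Ideal.span {x}) (QuotSMulTop x M) :=
  Module.Projective.of_equiv ((QuotSMulTop.equivQuotTensor x M).extendScalarsOfSurjective
    Ideal.Quotient.mk_surjective).symm

lemma QuotSMulTop.exists_shortExact {R : Type u} [CommRing R] {x : R} {N P M : Type u}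
    [AddCommGroup N] [Module R N] [AddCommGroup P] [Module R P] [AddCommGroup M] [Module R M]
    {f : N →ₗ[R] P} {g : P →ₗ[R] M} (hf : Function.Injective f) (hfg : Function.Exact f g)
    (hg : Function.Surjective g) (hM : IsSMulRegular M x) :
    ∃ (f' : QuotSMulTop x N →ₗ[R ⧸ Ideal.span {x}] QuotSMulTop x P)
      (g' : QuotSMulTop x P →ₗ[R ⧸ Ideal.span {x}] QuotSMulTop x M)
      (w : ModuleCat.ofHom f' ≫ ModuleCat.ofHom g' = 0),
      (ShortComplex.mk (ModuleCat.ofHom f') (ModuleCat.ofHom g') w).ShortExact := by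
  have hinj : Function.Injective (QuotSMulTop.map x f) := by
    have := QuotSMulTop.map_first_exact_on_four_term_exact_of_isSMulRegular_last
      (f₁ := (0 : N →ₗ[R] N)) ((LinearMap.exact_zero_iff_injective N f).2 hf) hfg hM
    rw [map_zero] at this
    exact (LinearMap.exact_zero_iff_injective _ _).1 this
  have hext {A B : Type u} [AddCommGroup A] [Module R A] [AddCommGroup B] [Module R B]
      (h : A →ₗ[R] B) : ∃ h' : QuotSMulTop x A →ₗ[R ⧸ Ideal.span {x}] QuotSMulTop x B,
      (h' : QuotSMulTop x A → QuotSMulTop x B) = QuotSMulTop.map x h :=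
    ⟨(QuotSMulTop.map x h).extendScalarsOfSurjective Ideal.Quotient.mk_surjective, rfl⟩
  obtain ⟨f', hf'⟩ := hext f
  obtain ⟨g', hg'⟩ := hext g
  have hfg' : Function.Exact f' g' := by
    rw [hf', hg']
    exact QuotSMulTop.map_exact x hfg hg
  refine ⟨f', g', ModuleCat.hom_ext (LinearMap.ext fun y ↦ hfg'.apply_apply_eq_zero y), ?_⟩
  exact {
    exact := (ShortComplex.ShortExact.moduleCat_exact_iff_function_exact _).2 hfg'
    mono_f := (ModuleCat.mono_iff_injective _).2 (by simpa [hf'] using hinj)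
    epi_g := (ModuleCat.epi_iff_surjective _).2
      (by simpa [hg'] using QuotSMulTop.map_surjective x hg) }

lemma QuotSMulTop.hasProjectiveDimensionLT {R : Type u} [CommRing R] {x : R}
    (hx : IsSMulRegular R x) (n : ℕ) : ∀ (M : Type u) [AddCommGroup M] [Module R M],
    IsSMulRegular M x → HasProjectiveDimensionLT (ModuleCat.of R M) (n + 1) →
    HasProjectiveDimensionLT (ModuleCat.of (R ⧸ Ideal.span {x}) (QuotSMulTop x M)) (n + 1) := by
  induction n with
  | zero =>
    intro M _ _ _ h
    rw [ModuleCat.hasProjectiveDimensionLT_one_iff] at h ⊢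
    infer_instance
  | succ n ih =>
    intro M _ _ hxM h
    let f : (M →₀ R) →ₗ[R] M := Finsupp.linearCombination R id
    have hf : Function.Surjective f := Finsupp.linearCombination_id_surjective R M
    have hxP : IsSMulRegular (M →₀ R) x := fun a b hab ↦ by
      ext i
      exact hx (DFunLike.congr_fun hab i)
    have hker : IsSMulRegular (LinearMap.ker f) x := hxP.submodule _ _
    have h' := ih _ hker ((ModuleCat.hasProjectiveDimensionLT_ker_iff hf n).1 h)
    obtain ⟨f', g', w, hS⟩ := QuotSMulTop.exists_shortExact (N := LinearMap.ker f)
      (P := M →₀ R) (M := M) (g := f) (f := (LinearMap.ker f).subtype) (LinearMap.ker f).injective_subtype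
      (LinearMap.exact_subtype_ker_map f) hf hxM
    exact (hS.hasProjectiveDimensionLT_X₃_iff n (inferInstanceAs (Projective
      (ModuleCat.of (R ⧸ Ideal.span {x}) (QuotSMulTop x (M →₀ R)))))).2 h'

/-- A finite free cover of a finite module over a local ring, with kernel inside `𝔪 F`. -/
lemma IsLocalRing.exists_minimal_cover (R : Type u) [CommRing R] [IsLocalRing R]
    (M : Type u) [AddCommGroup M] [Module R M] [Module.Finite R M] :
    ∃ (n : ℕ) (f : (Fin n → R) →ₗ[R] M), Function.Surjective f ∧
      ∀ v ∈ LinearMap.ker f, ∀ i, v i ∈ maximalIdeal R := by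
  classical
  have hex : ∃ n, ∃ f : (Fin n → R) →ₗ[R] M, Function.Surjective f := Module.Finite.exists_fin' R M
  obtain ⟨f, hf⟩ := Nat.find_spec hex
  have hmin := fun m ↦ Nat.find_min hex (m := m)
  generalize Nat.find hex = n at f hf hmin
  refine ⟨n, f, hf, fun v hv i ↦ ?_⟩
  by_contra hi
  have hu : IsUnit (v i) := by simpa using hi
  obtain _ | n := n
  · exact i.elim0
  refine hmin n (by omega) ⟨f ∘ₗ Function.ExtendByZero.linearMap R i.succAbove, fun m ↦ ?_⟩
  obtain ⟨w, rfl⟩ := hf m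
  obtain ⟨c, hc⟩ := hu.exists_right_inv
  let y : Fin (n + 1) → R := w - (w i * c) • v
  have hyi : y i = 0 := by
    simp only [y, Pi.sub_apply, Pi.smul_apply, smul_eq_mul]
    linear_combination - w i * hc
  have hy : Function.extend i.succAbove (y ∘ i.succAbove) 0 = y := by
    ext j
    obtain rfl | ⟨k, rfl⟩ := i.eq_self_or_eq_succAbove j
    · rw [Function.extend_apply' _ _ _ (by simp [Fin.succAbove_ne]), hyi, Pi.zero_apply]
    · rw [Fin.succAbove_right_injective.extend_apply, Function.comp_apply]
  refine ⟨y ∘ i.succAbove, ?_⟩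
  change f (Function.extend i.succAbove (y ∘ i.succAbove) 0) = _
  rw [hy, map_sub, map_smul,
    LinearMap.mem_ker.1 hv, smul_zero, sub_zero]

/-- Over a Noetherian local ring of depth zero, finite modules of finite projective dimension are
projective. -/
lemma IsLocalRing.projective_of_hasProjectiveDimensionLT {R : Type u} [CommRing R] [IsLocalRing R]
    [IsNoetherianRing R] {s : R} (hs : s ≠ 0) (hsm : ∀ a ∈ maximalIdeal R, s * a = 0) (n : ℕ) :
    ∀ (M : Type u) [AddCommGroup M] [Module R M] [Module.Finite R M],
    HasProjectiveDimensionLT (ModuleCat.of R M) (n + 1) → Module.Projective R M := by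
  induction n with
  | zero =>
    intro M _ _ _ h
    exact ModuleCat.hasProjectiveDimensionLT_one_iff.1 h
  | succ n ih =>
    intro M _ _ _ h
    obtain ⟨k, f, hf, hker⟩ := exists_minimal_cover R M
    have := ih _ ((ModuleCat.hasProjectiveDimensionLT_ker_iff hf n).1 h)
    have : Module.Free R (LinearMap.ker f) := Module.free_of_flat_of_isLocalRing
    have hbot : LinearMap.ker f = ⊥ := by
      by_contra hne
      have : Nontrivial (LinearMap.ker f) := (Submodule.nontrivial_iff_ne_bot).2 hne
      refine hs (FaithfulSMul.eq_of_smul_eq_smul (M := R) (α := LinearMap.ker f) fun v ↦ ?_)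
      ext i
      simpa using hsm _ (hker v v.2 i)
    exact Module.Projective.of_equiv (LinearEquiv.ofBijective f ⟨LinearMap.ker_eq_bot.1 hbot, hf⟩)

lemma IsLocalRing.maximalIdeal_eq_bot_of_projective_residueField {R : Type u} [CommRing R]
    [IsLocalRing R] [Module.Projective R (ResidueField R)] : maximalIdeal R = ⊥ := by
  have : Module.Free R (ResidueField R) := Module.free_of_flat_of_isLocalRing
  refine eq_bot_iff.2 fun a ha ↦ ?_
  refine FaithfulSMul.eq_of_smul_eq_smul (M := R) (α := ResidueField R) fun v ↦ ?_
  rw [Algebra.smul_def, ResidueField.algebraMap_eq, (residue_eq_zero_iff a).2 ha, zero_mul,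
    zero_smul]

lemma IsLocalRing.hasProjectiveDimensionLT_maximalIdeal_iff {R : Type u} [CommRing R]
    [IsLocalRing R] (n : ℕ) :
    HasProjectiveDimensionLT (ModuleCat.of R (ResidueField R)) (n + 2) ↔
      HasProjectiveDimensionLT (ModuleCat.of R (maximalIdeal R)) (n + 1) := by
  have hf : Function.Surjective (Algebra.linearMap R (ResidueField R)) := residue_surjective
  have hker : LinearMap.ker (Algebra.linearMap R (ResidueField R)) = maximalIdeal R := by
    ext a
    exact residue_eq_zero_iff a
  rw [ModuleCat.hasProjectiveDimensionLT_ker_iff hf]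
  have e := (LinearEquiv.ofEq _ _ hker).toModuleIso
  exact ⟨fun _ ↦ hasProjectiveDimensionLT_of_iso e _,
    fun _ ↦ hasProjectiveDimensionLT_of_iso e.symm _⟩

lemma IsLocalRing.exists_linearMap_eq_one {R : Type u} [CommRing R] [IsLocalRing R]
    {x : R} (hx : x ∈ maximalIdeal R) (hx2 : x ∉ maximalIdeal R ^ 2) :
    ∃ g : maximalIdeal R →ₗ[R] ResidueField R, g ⟨x, hx⟩ = 1 := by
  have hne : (maximalIdeal R).toCotangent ⟨x, hx⟩ ≠ 0 := by
    rwa [Ne, Ideal.toCotangent_eq_zero]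
  obtain ⟨φ, hφ⟩ := Module.Projective.exists_dual_ne_zero (ResidueField R)
    (V := CotangentSpace R) hne
  refine ⟨(((φ ((maximalIdeal R).toCotangent ⟨x, hx⟩))⁻¹ • φ).restrictScalars R) ∘ₗ
    (maximalIdeal R).toCotangent, ?_⟩
  exact inv_mul_cancel₀ hφ

lemma IsLocalRing.nonempty_retract_quotSMulTop_maximalIdeal {R : Type u} [CommRing R] [IsLocalRing R]
    {x : R} (hx : x ∈ maximalIdeal R) (hx2 : x ∉ maximalIdeal R ^ 2)
    [IsLocalRing (R ⧸ Ideal.span {x})] :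
    Nonempty (Retract (ModuleCat.of (R ⧸ Ideal.span {x}) (ResidueField (R ⧸ Ideal.span {x})))
      (ModuleCat.of (R ⧸ Ideal.span {x}) (QuotSMulTop x (maximalIdeal R)))) := by
  let S := R ⧸ Ideal.span {x}
  let k := ResidueField S
  obtain ⟨g, hg⟩ := exists_linearMap_eq_one hx hx2
  have hloc : IsLocalHom (Ideal.Quotient.mk (Ideal.span {x})) :=
    IsLocalHom.of_surjective _ Ideal.Quotient.mk_surjective
  let h : ResidueField R →ₗ[R] k :=
    { toFun := ResidueField.map (Ideal.Quotient.mk (Ideal.span {x}))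
      map_add' := map_add _
      map_smul' := fun r c ↦ by
        rw [Algebra.smul_def, map_mul, Algebra.smul_def]
        rfl }
  have h1 : h 1 = 1 := map_one (ResidueField.map (Ideal.Quotient.mk (Ideal.span {x})))
  have hxk (c : k) : x • c = 0 := by
    have h0 : algebraMap R k x = 0 := by
      change residue S (Ideal.Quotient.mk _ x) = 0
      rw [Ideal.Quotient.eq_zero_iff_mem.2 (Ideal.mem_span_singleton_self x), map_zero]
    rw [Algebra.smul_def, h0, zero_mul]
  let r₀ : QuotSMulTop x (maximalIdeal R) →ₗ[R] k := Submodule.liftQ _ (h ∘ₗ g) (by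
    intro y hy
    obtain ⟨z, -, rfl⟩ := (Submodule.mem_smul_pointwise_iff_exists _ _ _).1 hy
    rw [LinearMap.mem_ker, map_smul, hxk])
  let r : QuotSMulTop x (maximalIdeal R) →ₗ[S] k :=
    r₀.extendScalarsOfSurjective Ideal.Quotient.mk_surjective
  let q : QuotSMulTop x (maximalIdeal R) := Submodule.Quotient.mk ⟨x, hx⟩
  have hrq : r q = 1 := by
    change h (g ⟨x, hx⟩) = 1
    rw [hg, h1]
  let i : k →ₗ[S] QuotSMulTop x (maximalIdeal R) :=
    Submodule.liftQ (maximalIdeal S) (LinearMap.toSpanSingleton S _ q) (by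
      intro a ha
      obtain ⟨a, rfl⟩ := Ideal.Quotient.mk_surjective a
      have ha : a ∈ maximalIdeal R := by
        rw [mem_maximalIdeal, mem_nonunits_iff] at ha ⊢
        exact fun hu ↦ ha (hu.map _)
      rw [LinearMap.mem_ker, LinearMap.toSpanSingleton_apply]
      change (Submodule.Quotient.mk (a • ⟨x, hx⟩) : QuotSMulTop x (maximalIdeal R)) = 0
      rw [Submodule.Quotient.mk_eq_zero]
      refine (Submodule.mem_smul_pointwise_iff_exists _ _ _).2 ⟨⟨a, ha⟩, trivial, ?_⟩
      ext
      exact mul_comm _ _)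
  have hri : r ∘ₗ i = LinearMap.id := by
    refine LinearMap.ext fun c ↦ ?_
    obtain ⟨c, rfl⟩ := residue_surjective c
    change r (c • q) = residue _ c
    rw [map_smul, hrq, Algebra.smul_def, mul_one]
    rfl
  exact ⟨{ i := ModuleCat.ofHom i, r := ModuleCat.ofHom r, retract := ModuleCat.hom_ext hri }⟩

theorem IsLocalRing.exists_span_card_of_hasProjectiveDimensionLT (d : ℕ) : ∀ (R : Type u) [CommRing R]
    [IsLocalRing R] [IsNoetherianRing R] (n : ℕ),
    HasProjectiveDimensionLT (ModuleCat.of R (ResidueField R)) n →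
    ringKrullDim R < d →
    ∃ s : Finset R, Ideal.span (s : Set R) = maximalIdeal R ∧
      (s.card : WithBot ℕ∞) ≤ ringKrullDim R := by
  classical
  induction d with
  | zero =>
    intro R _ _ _ n _ hd
    exact absurd hd (not_lt.2 ringKrullDim_nonneg_of_nontrivial)
  | succ d ih =>
    intro R _ _ _ n hn hd
    by_cases hbot : maximalIdeal R = ⊥
    · exact ⟨∅, by simp [hbot], by simpa using ringKrullDim_nonneg_of_nontrivial⟩
    by_cases hass : maximalIdeal R ∈ associatedPrimes R R
    · obtain ⟨hp, s, hs⟩ := isAssociatedPrime_iff.1 hass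
      have hs0 : s ≠ 0 := by
        rintro rfl
        exact hp.ne_top (by rw [hs, Ideal.eq_top_iff_one, Submodule.mem_colon_singleton]; simp)
      have := projective_of_hasProjectiveDimensionLT hs0 (fun a ha ↦ by
        rw [hs, Submodule.mem_colon_singleton, Submodule.mem_bot, smul_eq_mul, mul_comm] at ha
        exact ha) n (ResidueField R) (hasProjectiveDimensionLT_of_ge _ n (n + 1) (by omega))
      exact absurd maximalIdeal_eq_bot_of_projective_residueField hbot
    obtain ⟨x, hx, hx2, hxa⟩ := exists_mem_maximalIdeal_notMem_sq hbot
      (associatedPrimes.finite R R) (fun p hp ↦ hp.isPrime) hass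
    have hreg : IsSMulRegular R x := by
      have : x ∈ (⋃ p ∈ associatedPrimes R R, (p : Set R))ᶜ := by simpa using hxa
      rwa [biUnion_associatedPrimes_eq_compl_regular, compl_compl] at this
    have := isLocalRing_quotient_span_singleton hx
    have hdim := ringKrullDim_quotient_span_singleton_succ_eq_ringKrullDim hreg hx
    have hpd := QuotSMulTop.hasProjectiveDimensionLT hreg n _ (hreg.submodule (maximalIdeal R) _)
      ((hasProjectiveDimensionLT_maximalIdeal_iff n).1
        (hasProjectiveDimensionLT_of_ge _ n (n + 2) (by omega)))
    obtain ⟨ρ⟩ := nonempty_retract_quotSMulTop_maximalIdeal hx hx2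
    have := ρ.hasProjectiveDimensionLT (n + 1)
    obtain ⟨t, ht, htc⟩ := ih (R ⧸ Ideal.span {x}) (n + 1) this (by
      rw [← hdim] at hd
      push_cast at hd
      by_contra! h
      exact absurd hd (not_lt.2 (by gcongr)))
    obtain ⟨σ, hσ⟩ := (Ideal.Quotient.mk_surjective (I := Ideal.span {x})).hasRightInverse
    refine ⟨insert x (t.image σ), ?_, ?_⟩
    · have himage : (Ideal.Quotient.mk (Ideal.span {x}) '' (σ '' t)) = t := by
        rw [← Set.image_comp, hσ.comp_eq_id, Set.image_id]
      rw [Finset.coe_insert, Finset.coe_image,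
        ← Ideal.comap_map_mk (I := Ideal.span {x}) (J := Ideal.span (insert x (σ '' t)))
          (Ideal.span_mono (by simp)), Ideal.map_span, Set.image_insert_eq, himage,
        Ideal.Quotient.eq_zero_iff_mem.2 (Ideal.mem_span_singleton_self x), Ideal.span_insert_zero,
        ht, ← map_maximalIdeal_of_surjective _ Ideal.Quotient.mk_surjective]
      exact Ideal.comap_map_mk ((Ideal.span_singleton_le_iff_mem _).2 hx)
    · rw [← hdim]
      have h1 : (insert x (t.image σ)).card ≤ t.card + 1 :=
        (Finset.card_insert_le _ _).trans (by gcongr; exact Finset.card_image_le)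
      calc ((insert x (t.image σ)).card : WithBot ℕ∞) ≤ ((t.card + 1 : ℕ) : WithBot ℕ∞) := by
            exact_mod_cast h1
        _ = (t.card : WithBot ℕ∞) + 1 := by push_cast; rfl
        _ ≤ _ := by gcongr

/-- A bounded cochain complex of finitely generated projective modules. -/
structure IsBoundedFiniteProjective {R : Type u} [CommRing R]
    (K : CochainComplex (ModuleCat.{u} R) ℤ) : Prop where
  bounded : ∃ a b : ℤ, ∀ i : ℤ, (i < a ∨ b < i) → IsZero (K.X i)
  finite_projective : ∀ i : ℤ, Module.Finite R (K.X i) ∧ Module.Projective R (K.X i)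

/-- A module which is isomorphic in the derived category to a bounded complex of finitely generated
projective modules. -/
def IsPerfectModule {R : Type u} [CommRing R] [HasDerivedCategory.{w} (ModuleCat.{u} R)]
    (M : ModuleCat.{u} R) : Prop :=
  ∃ K : CochainComplex (ModuleCat.{u} R) ℤ, IsBoundedFiniteProjective K ∧
    Nonempty (DerivedCategory.Q.obj K ≅ (DerivedCategory.singleFunctor (ModuleCat.{u} R) 0).obj M)

section

variable {R : Type u} [CommRing R]

lemma IsBoundedFiniteProjective.mappingCone {K L : CochainComplex (ModuleCat.{u} R) ℤ}
    (hK : IsBoundedFiniteProjective K) (hL : IsBoundedFiniteProjective L) (f : K ⟶ L) :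
    IsBoundedFiniteProjective (CochainComplex.mappingCone f) where
  bounded := by
    obtain ⟨a, b, h⟩ := hK.bounded
    obtain ⟨a', b', h'⟩ := hL.bounded
    refine ⟨min (a - 1) a', max b b', fun i hi ↦ ?_⟩
    rw [CochainComplex.mappingCone.isZero_X_iff]
    exact ⟨h _ (by omega), h' _ (by omega)⟩
  finite_projective i := by
    have e := (HomologicalComplex.homotopyCofiber.XIsoBiprod f i (i + 1) rfl ≪≫
      ModuleCat.biprodIsoProd _ _).toLinearEquiv
    obtain ⟨_, _⟩ := hK.finite_projective (i + 1)
    obtain ⟨_, _⟩ := hL.finite_projective i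
    exact ⟨Module.Finite.equiv (M := K.X (i + 1) × L.X i) e.symm,
      Module.Projective.of_equiv (M := K.X (i + 1) × L.X i) e.symm⟩

lemma isBoundedFiniteProjective_single :
    IsBoundedFiniteProjective ((HomologicalComplex.single (ModuleCat.{u} R)
      (ComplexShape.up ℤ) 0).obj (ModuleCat.of R R)) where
  bounded := ⟨0, 0, fun i hi ↦ HomologicalComplex.isZero_single_obj_X _ _ _ _ (by omega)⟩
  finite_projective i := by
    by_cases hi : i = 0
    · subst hi
      have e := (HomologicalComplex.singleObjXSelf (ComplexShape.up ℤ) (0 : ℤ)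
        (ModuleCat.of R R)).toLinearEquiv
      exact ⟨Module.Finite.equiv (M := R) e.symm, Module.Projective.of_equiv (M := R) e.symm⟩
    · have := ModuleCat.isZero_iff_subsingleton.1 (HomologicalComplex.isZero_single_obj_X
        (ComplexShape.up ℤ) (0 : ℤ) (ModuleCat.of R R) i hi)
      exact ⟨inferInstance, inferInstance⟩

variable [HasDerivedCategory.{w} (ModuleCat.{u} R)]

lemma isPerfectModule_self : IsPerfectModule (ModuleCat.of R R) :=
  ⟨_, isBoundedFiniteProjective_single, ⟨Iso.refl _⟩⟩

lemma IsPerfectModule.of_iso {M N : ModuleCat.{u} R} (hM : IsPerfectModule M) (e : M ≅ N) :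
    IsPerfectModule N := by
  obtain ⟨K, hK, ⟨e'⟩⟩ := hM
  exact ⟨K, hK, ⟨e' ≪≫ (DerivedCategory.singleFunctor _ 0).mapIso e⟩⟩

lemma IsPerfectModule.quotSMulTop {M : ModuleCat.{u} R} (hM : IsPerfectModule M) {x : R}
    (hx : IsSMulRegular M x) : IsPerfectModule (ModuleCat.of R (QuotSMulTop x M)) := by
  obtain ⟨K, hK, ⟨e⟩⟩ := hM
  have hS : (ModuleCat.smulShortComplex M x).ShortExact := hx.smulShortComplex_shortExact
  refine ⟨CochainComplex.mappingCone (x • 𝟙 K), hK.mappingCone hK _, ⟨?_⟩⟩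
  exact Pretriangulated.Triangle.π₃.mapIso (Pretriangulated.isoTriangleOfIso₁₂ _ _
    (DerivedCategory.mappingCone_triangle_distinguished (x • 𝟙 K))
    hS.singleTriangle_distinguished e e (by
      change DerivedCategory.Q.map (x • 𝟙 K) ≫ e.hom =
        e.hom ≫ (DerivedCategory.singleFunctor (ModuleCat R) 0).map (x • 𝟙 M)
      rw [Functor.map_smul, Functor.map_smul, CategoryTheory.Functor.map_id,
        CategoryTheory.Functor.map_id, Linear.smul_comp, Linear.comp_smul, Category.id_comp,
        Category.comp_id]))

lemma IsPerfectModule.quotient_ofList (rs : List R) : ∀ {M : ModuleCat.{u} R}, IsPerfectModule M →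
    RingTheory.Sequence.IsWeaklyRegular M rs →
    IsPerfectModule (ModuleCat.of R (M ⧸ (Ideal.ofList rs • ⊤ : Submodule R M))) := by
  induction rs with
  | nil =>
    intro M hM _
    refine hM.of_iso (LinearEquiv.toModuleIso (Submodule.quotEquivOfEqBot _ (by simp)).symm)
  | cons r rs ih =>
    intro M hM h
    rw [RingTheory.Sequence.isWeaklyRegular_cons_iff] at h
    exact (ih (hM.quotSMulTop h.1) h.2).of_iso (LinearEquiv.toModuleIso
      (Submodule.quotOfListConsSMulTopEquivQuotSMulTopInner M r rs).symm)

lemma CochainComplex.derivedCategory_hom_eq_zero_of_isKProjective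
    {K L : CochainComplex (ModuleCat.{u} R) ℤ} [K.IsKProjective] (h : ∀ g : K ⟶ L, g = 0)
    (f : DerivedCategory.Q.obj K ⟶ DerivedCategory.Q.obj L) : f = 0 := by
  let e (M : CochainComplex (ModuleCat.{u} R) ℤ) :
      DerivedCategory.Qh.obj ((HomotopyCategory.quotient _ _).obj M) ≅ DerivedCategory.Q.obj M :=
    (DerivedCategory.quotientCompQhIso _).app M
  obtain ⟨g, hg⟩ := (CochainComplex.IsKProjective.Qh_map_bijective K _).surjective
    ((e K).hom ≫ f ≫ (e L).inv)
  obtain ⟨g, rfl⟩ := (HomotopyCategory.quotient _ _).map_surjective g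
  rw [h g, Functor.map_zero, Functor.map_zero] at hg
  have : f = (e K).inv ≫ ((e K).hom ≫ f ≫ (e L).inv) ≫ (e L).hom := by simp
  rw [this, ← hg, zero_comp, comp_zero]

lemma hasProjectiveDimensionLT_of_isPerfectModule {M : ModuleCat.{u} R} (hM : IsPerfectModule M) :
    ∃ n, HasProjectiveDimensionLT M n := by
  obtain ⟨K, hK, ⟨e⟩⟩ := hM
  obtain ⟨a, b, hab⟩ := hK.bounded
  have hle : K.IsStrictlyLE b := by
    rw [CochainComplex.isStrictlyLE_iff]
    intro i hi
    exact hab i (.inr hi)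
  have hproj (n : ℤ) : Projective (K.X n) :=
    (IsProjective.iff_projective _).1 (hK.finite_projective n).2
  have := CochainComplex.isKProjective_of_projective K b
  have := hasExt_of_hasDerivedCategory (ModuleCat.{u} R)
  refine ⟨(1 - a).toNat, ?_⟩
  rw [hasProjectiveDimensionLT_iff]
  intro i hi Y f
  have hz : IsZero (K.X (-i)) := hab _ (.inl (by omega))
  have e₂ : ((DerivedCategory.singleFunctor (ModuleCat.{u} R) 0).obj Y)⟦(i : ℤ)⟧ ≅
      (DerivedCategory.singleFunctor (ModuleCat.{u} R) (-i)).obj Y :=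
    ((DerivedCategory.singleFunctors (ModuleCat.{u} R)).shiftIso i (-i) 0 (by omega)).app Y
  have h (φ : (DerivedCategory.singleFunctor (ModuleCat.{u} R) 0).obj M ⟶
      ((DerivedCategory.singleFunctor (ModuleCat.{u} R) 0).obj Y)⟦(i : ℤ)⟧) : φ = 0 := by
    have := CochainComplex.derivedCategory_hom_eq_zero_of_isKProjective (K := K)
      (L := (HomologicalComplex.single (ModuleCat.{u} R) (ComplexShape.up ℤ) (-i)).obj Y)
      (fun g ↦ HomologicalComplex.to_single_hom_ext (hz.eq_of_src _ _)) (e.hom ≫ φ ≫ e₂.hom)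
    change _ ≫ _ ≫ _ = (0 : _ ⟶ (DerivedCategory.singleFunctor (ModuleCat.{u} R) (-i)).obj Y)
      at this
    simpa using this
  exact Abelian.Ext.homEquiv.injective ((h _).trans (h _).symm)

end

/-- Auslander–Buchsbaum–Serre: for a commutative Noetherian local ring `R` with residue
field `k`, the module `k` is a small object of `D(R)` — i.e. isomorphic in the derived
category to a bounded complex of finitely generated projective modules — if and only if `R`
is regular (the maximal ideal is generated by `dim R` elements). -/
theorem stmt14 (R : Type) [CommRing R] [IsNoetherianRing R] [IsLocalRing R]
    [HasDerivedCategory (ModuleCat R)] :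
    (∃ K : CochainComplex (ModuleCat R) ℤ,
      (∃ a b : ℤ, ∀ i : ℤ, (i < a ∨ b < i) → IsZero (K.X i)) ∧
      (∀ i : ℤ, Module.Finite R (K.X i) ∧ Module.Projective R (K.X i)) ∧
      Nonempty (DerivedCategory.Q.obj K ≅
        DerivedCategory.Q.obj ((HomologicalComplex.single (ModuleCat R)
          (ComplexShape.up ℤ) 0).obj (ModuleCat.of R (ResidueField R))))) ↔
    (∃ s : Finset R, Ideal.span (s : Set R) = maximalIdeal R ∧
      (s.card : WithBot (WithTop ℕ)) = ringKrullDim R) := by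
  constructor
  · rintro ⟨K, hb, hp, e⟩
    obtain ⟨n, hn⟩ := hasProjectiveDimensionLT_of_isPerfectModule ⟨K, ⟨hb, hp⟩, e⟩
    obtain ⟨d, hd⟩ : ∃ d : ℕ, ringKrullDim R < d := by
      refine ⟨(maximalIdeal R).spanFinrank + 1,
        (ringKrullDim_le_spanFinrank_maximalIdeal R).trans_lt ?_⟩
      exact_mod_cast Nat.lt_succ_self _
    obtain ⟨s, hs, hsc⟩ := exists_span_card_of_hasProjectiveDimensionLT d R n hn hd
    refine ⟨s, hs, le_antisymm hsc ((ringKrullDim_le_spanFinrank_maximalIdeal R).trans ?_)⟩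
    have := Submodule.spanFinrank_span_le_ncard_of_finite (R := R) s.finite_toSet
    rw [← Ideal.span, hs, Set.ncard_coe_finset] at this
    have h : ((maximalIdeal R).spanFinrank : WithBot ℕ∞) ≤ (s.card : WithBot ℕ∞) := by
      exact_mod_cast this
    exact h
  · rintro ⟨s, hs, hsc⟩
    have hlist : Ideal.ofList s.toList = maximalIdeal R := by
      rw [← hs, Ideal.ofList]
      congr
      ext
      simp
    have hreg := isWeaklyRegular_of_length_le_ringKrullDim s.card R s.toList hlist
      s.length_toList hsc.le
    have hperf := IsPerfectModule.quotient_ofList s.toList (isPerfectModule_self (R := R)) hreg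
    obtain ⟨K, hK, e⟩ := hperf.of_iso (N := ModuleCat.of R (ResidueField R))
      (LinearEquiv.toModuleIso (Submodule.quotEquivOfEq _ (maximalIdeal R) (by simp [hlist])))
    exact ⟨K, hK.bounded, hK.finite_projective, e⟩
end
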